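/- arXiv:2408.15427 — 4 statements merged into one kernel-verified Lean document; each statement's English description precedes it below -/
import Mathlib

section
/- Fix ω > 0 and define the bounded ℂ²-valued functions Φ₊(x) := (tanh²(√ω x), −sech²(√ω x)) and Φ₋(x) := (−sech²(√ω x), tanh²(√ω x)). Then H(ω)Φ₊ = ω Φ₊ and H(ω)Φ₋ = −ω Φ₋ hold pointwise at every x ∈ ℝ; that is, Φ₊ and Φ₋ are threshold resonances of H(ω) at the edges ±ω of the essential spectrum. -/
open MeasureTheory

/-- `sech x = 1 / cosh x`. -/
noncomputable def sech (x : ℝ) : ℝ := 1 / Real.cosh x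

/-- The ground state `φ_ω(x) = √(2ω) sech(√ω x)`. -/
noncomputable def phi (ω x : ℝ) : ℝ := Real.sqrt (2 * ω) * sech (Real.sqrt ω * x)

/-- The matrix Schrödinger operator `H(ω)` acting on a pair `U = (u₁, u₂)` of functions
`ℝ → ℂ`, evaluated pointwise:
`H(ω)U = (−u₁″ + ω u₁ − 2φ_ω²u₁ − φ_ω²u₂, u₂″ − ω u₂ + φ_ω²u₁ + 2φ_ω²u₂)`. -/
noncomputable def Hop (ω : ℝ) (U : (ℝ → ℂ) × (ℝ → ℂ)) (x : ℝ) : ℂ × ℂ :=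
  (-(deriv (deriv U.1) x) + (ω : ℂ) * U.1 x - 2 * ((phi ω x : ℝ) : ℂ) ^ 2 * U.1 x -
      ((phi ω x : ℝ) : ℂ) ^ 2 * U.2 x,
    deriv (deriv U.2) x - (ω : ℂ) * U.2 x + ((phi ω x : ℝ) : ℂ) ^ 2 * U.1 x +
      2 * ((phi ω x : ℝ) : ℂ) ^ 2 * U.2 x)

/-- The threshold resonance `Φ₊ = (tanh²(√ω x), −sech²(√ω x))`. -/
noncomputable def Phip (ω : ℝ) : (ℝ → ℂ) × (ℝ → ℂ) :=
  (fun x => ((Real.tanh (Real.sqrt ω * x) ^ 2 : ℝ) : ℂ),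
   fun x => ((-(sech (Real.sqrt ω * x) ^ 2) : ℝ) : ℂ))

/-- The threshold resonance `Φ₋ = (−sech²(√ω x), tanh²(√ω x))`. -/
noncomputable def Phim (ω : ℝ) : (ℝ → ℂ) × (ℝ → ℂ) :=
  (fun x => ((-(sech (Real.sqrt ω * x) ^ 2) : ℝ) : ℂ),
   fun x => ((Real.tanh (Real.sqrt ω * x) ^ 2 : ℝ) : ℂ))

theorem tanh_eq_sinh_mul_sech (y : ℝ) : Real.tanh y = Real.sinh y * sech y := by
  rw [Real.tanh_eq_sinh_div_cosh, sech]
  ring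

theorem tanh_sq_add_sech_sq (y : ℝ) : Real.tanh y ^ 2 + sech y ^ 2 = 1 := by
  have hc := (Real.cosh_pos y).ne'
  rw [Real.tanh_eq_sinh_div_cosh, sech]
  field_simp
  linarith [Real.cosh_sq y]

theorem hasDerivAt_sech (y : ℝ) : HasDerivAt sech (-(sech y * Real.tanh y)) y := by
  have h := (Real.hasDerivAt_cosh y).inv (Real.cosh_pos y).ne'
  have hs : sech = Real.cosh⁻¹ := by
    funext z
    simp [sech]
  rw [Real.tanh_eq_sinh_div_cosh, hs]
  refine h.congr_deriv ?_
  have hc := (Real.cosh_pos y).ne'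
  simp only [Pi.inv_apply]
  field_simp

theorem hasDerivAt_tanh_sech (y : ℝ) : HasDerivAt Real.tanh (sech y ^ 2) y := by
  have h := (Real.hasDerivAt_sinh y).mul (hasDerivAt_sech y)
  have ht : Real.tanh = Real.sinh * sech := funext tanh_eq_sinh_mul_sech
  rw [ht]
  refine h.congr_deriv ?_
  have hc := (Real.cosh_pos y).ne'
  rw [Real.tanh_eq_sinh_div_cosh, sech]
  field_simp
  linarith [Real.cosh_sq y]

theorem hasDerivAt_sech_sq (a x : ℝ) :
    HasDerivAt (fun x => sech (a * x) ^ 2)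
      (-(2 * a) * (sech (a * x) ^ 2 * Real.tanh (a * x))) x := by
  have hl : HasDerivAt (fun x => a * x) a x := by
    simpa using (hasDerivAt_id x).const_mul a
  have h := ((hasDerivAt_sech (a * x)).comp x hl).pow 2
  refine h.congr_deriv ?_
  simp only [Function.comp_apply]
  ring

theorem hasDerivAt_deriv_sech_sq (a x : ℝ) :
    HasDerivAt (fun x => -(2 * a) * (sech (a * x) ^ 2 * Real.tanh (a * x)))
      (a ^ 2 * (4 * sech (a * x) ^ 2 - 6 * sech (a * x) ^ 4)) x := by
  have hl : HasDerivAt (fun x => a * x) a x := by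
    simpa using (hasDerivAt_id x).const_mul a
  have h := ((hasDerivAt_sech_sq a x).mul
    ((hasDerivAt_tanh_sech (a * x)).comp x hl)).const_mul (-(2 * a))
  refine h.congr_deriv ?_
  simp only [Function.comp_apply]
  linear_combination 4 * a ^ 2 * sech (a * x) ^ 2 * tanh_sq_add_sech_sq (a * x)

theorem deriv_deriv_ofReal_neg_sech_sq (a x : ℝ) :
    deriv (deriv fun x : ℝ => ((-(sech (a * x) ^ 2) : ℝ) : ℂ)) x =
      ((-(a ^ 2 * (4 * sech (a * x) ^ 2 - 6 * sech (a * x) ^ 4)) : ℝ) : ℂ) := by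
  rw [show (deriv fun x : ℝ => ((-(sech (a * x) ^ 2) : ℝ) : ℂ)) = _ from
    funext fun y => (hasDerivAt_sech_sq a y).neg.ofReal_comp.deriv]
  exact (hasDerivAt_deriv_sech_sq a x).neg.ofReal_comp.deriv

theorem deriv_deriv_ofReal_tanh_sq (a x : ℝ) :
    deriv (deriv fun x : ℝ => ((Real.tanh (a * x) ^ 2 : ℝ) : ℂ)) x =
      ((-(a ^ 2 * (4 * sech (a * x) ^ 2 - 6 * sech (a * x) ^ 4)) : ℝ) : ℂ) := by
  have ht : (fun x : ℝ => ((Real.tanh (a * x) ^ 2 : ℝ) : ℂ)) =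
      fun x : ℝ => ((-(sech (a * x) ^ 2) : ℝ) : ℂ) + 1 := by
    funext y
    rw [eq_sub_of_add_eq (tanh_sq_add_sech_sq (a * y))]
    push_cast
    ring
  rw [ht, show (deriv fun x : ℝ => ((-(sech (a * x) ^ 2) : ℝ) : ℂ) + 1) =
    deriv fun x : ℝ => ((-(sech (a * x) ^ 2) : ℝ) : ℂ) from funext fun y => deriv_add_const _]
  exact deriv_deriv_ofReal_neg_sech_sq a x

/-- `Φ₊` and `Φ₋` are threshold resonances of `H(ω)`:
`H(ω)Φ₊ = ω Φ₊` and `H(ω)Φ₋ = −ω Φ₋` pointwise at every `x ∈ ℝ`. -/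
theorem threshold_resonances (ω : ℝ) (hω : 0 < ω) :
    (∀ x : ℝ, Hop ω (Phip ω) x = ((ω : ℂ) * (Phip ω).1 x, (ω : ℂ) * (Phip ω).2 x)) ∧
    (∀ x : ℝ, Hop ω (Phim ω) x = (-(ω : ℂ) * (Phim ω).1 x, -(ω : ℂ) * (Phim ω).2 x)) := by
  have hphi (x : ℝ) : phi ω x ^ 2 = 2 * ω * sech (√ω * x) ^ 2 := by
    rw [phi, mul_pow, Real.sq_sqrt (by positivity)]
  constructor <;> intro x <;>
    simp only [Hop, Phip, Phim, deriv_deriv_ofReal_neg_sech_sq, deriv_deriv_ofReal_tanh_sq,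
      Prod.mk.injEq, ← Complex.ofReal_pow, hphi, Real.sq_sqrt hω.le,
      eq_sub_of_add_eq (tanh_sq_add_sech_sq (√ω * x))] <;>
    constructor <;> push_cast <;> ring
end

section
/- Let z ∈ ℂ and let μ, ν ∈ ℂ satisfy μ² = 1 − z and ν² = 1 + z. Define the ℂ²-valued functions f₁(x) := ((μ − tanh x)² e^{μx}, −sech²(x) e^{μx}), g₂(x) := ((μ + tanh x)² e^{−μx}, −sech²(x) e^{−μx}), f₃(x) := (−sech²(x) e^{−νx}, (ν + tanh x)² e^{−νx}), g₄(x) := (−sech²(x) e^{νx}, (ν − tanh x)² e^{νx}). Then each of f₁, g₂, f₃, g₄ solves H(1)f = z f pointwise on ℝ; that is, writing f = (f⁽¹⁾, f⁽²⁾), at every x ∈ ℝ one has −(f⁽¹⁾)″ + f⁽¹⁾ − 4 sech²(x) f⁽¹⁾ − 2 sech²(x) f⁽²⁾ = z f⁽¹⁾ and (f⁽²⁾)″ − f⁽²⁾ + 2 sech²(x) f⁽¹⁾ + 4 sech²(x) f⁽²⁾ = z f⁽²⁾. -/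
open MeasureTheory

/-- `f = (f⁽¹⁾, f⁽²⁾)` solves `H(1)f = z f` pointwise on `ℝ`, i.e. at every `x ∈ ℝ` one has
`−(f⁽¹⁾)″ + f⁽¹⁾ − 4 sech²(x) f⁽¹⁾ − 2 sech²(x) f⁽²⁾ = z f⁽¹⁾` and
`(f⁽²⁾)″ − f⁽²⁾ + 2 sech²(x) f⁽¹⁾ + 4 sech²(x) f⁽²⁾ = z f⁽²⁾`. -/
def SolvesH1 (z : ℂ) (f₁ f₂ : ℝ → ℂ) : Prop :=
  ∀ x : ℝ,
    (-(deriv (deriv f₁) x) + f₁ x - 4 * ((sech x : ℝ) : ℂ) ^ 2 * f₁ x -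
        2 * ((sech x : ℝ) : ℂ) ^ 2 * f₂ x = z * f₁ x) ∧
    (deriv (deriv f₂) x - f₂ x + 2 * ((sech x : ℝ) : ℂ) ^ 2 * f₁ x +
        4 * ((sech x : ℝ) : ℂ) ^ 2 * f₂ x = z * f₂ x)

theorem sech_sq_eq (x : ℝ) : ((sech x : ℝ) : ℂ) ^ 2 = 1 - (Real.tanh x : ℂ) ^ 2 := by
  have h : sech x ^ 2 = 1 - Real.tanh x ^ 2 := by
    have hc := (Real.cosh_pos x).ne'
    rw [sech, Real.tanh_eq_sinh_div_cosh]
    field_simp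
    linarith [Real.cosh_sq x]
  exact_mod_cast h

theorem hasDerivAt_ofReal_tanh (x : ℝ) :
    HasDerivAt (fun y : ℝ => (Real.tanh y : ℂ)) (1 - (Real.tanh x : ℂ) ^ 2) x := by
  have h : HasDerivAt Real.tanh (1 - Real.tanh x ^ 2) x := by
    have hc := (Real.cosh_pos x).ne'
    have hq := (Real.hasDerivAt_sinh x).div (Real.hasDerivAt_cosh x) hc
    have he : Real.tanh = Real.sinh / Real.cosh := funext Real.tanh_eq_sinh_div_cosh
    rw [he]
    refine hq.congr_deriv ?_
    rw [Pi.div_apply]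
    field_simp
  exact_mod_cast h.ofReal_comp

theorem hasDerivAt_exp_mul_ofReal (μ : ℂ) (x : ℝ) :
    HasDerivAt (fun y : ℝ => Complex.exp (μ * (y : ℂ))) (μ * Complex.exp (μ * (x : ℂ))) x := by
  simpa [mul_comm] using ((hasDerivAt_id x).ofReal_comp.const_mul μ).cexp

theorem deriv_deriv_mul_exp {A A' : ℝ → ℂ} {A'' μ : ℂ} {x : ℝ}
    (hA : ∀ y, HasDerivAt A (A' y) y) (hA' : HasDerivAt A' A'' x) :
    deriv (deriv fun y : ℝ => A y * Complex.exp (μ * (y : ℂ))) x =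
      (A'' + 2 * μ * A' x + μ ^ 2 * A x) * Complex.exp (μ * (x : ℂ)) := by
  have hE := hasDerivAt_exp_mul_ofReal μ
  rw [show (deriv fun y : ℝ => A y * Complex.exp (μ * (y : ℂ))) = fun y : ℝ =>
      A' y * Complex.exp (μ * (y : ℂ)) + A y * (μ * Complex.exp (μ * (y : ℂ))) from
    funext fun y => ((hA y).mul (hE y)).deriv]
  refine ((hA'.mul (hE x)).add ((hA x).mul ((hE x).const_mul μ))).deriv.trans ?_
  ring

/-- The equation is invariant under exchanging the components and replacing `z` by `-z`. -/
theorem SolvesH1.swap {z : ℂ} {f₁ f₂ : ℝ → ℂ} (h : SolvesH1 (-z) f₁ f₂) :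
    SolvesH1 z f₂ f₁ := fun x =>
  ⟨by linear_combination -(h x).2, by linear_combination -(h x).1⟩

theorem solvesH1_tanh_exp (z μ : ℂ) (hμ : μ ^ 2 = 1 - z) :
    SolvesH1 z
      (fun x => (μ - (Real.tanh x : ℂ)) ^ 2 * Complex.exp (μ * (x : ℂ)))
      (fun x => -((sech x : ℝ) : ℂ) ^ 2 * Complex.exp (μ * (x : ℂ))) := by
  intro x
  simp only [sech_sq_eq]
  have hT := hasDerivAt_ofReal_tanh
  have hA (y : ℝ) : HasDerivAt (fun y : ℝ => (μ - (Real.tanh y : ℂ)) ^ 2)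
      (-2 * ((μ - (Real.tanh y : ℂ)) * (1 - (Real.tanh y : ℂ) ^ 2))) y :=
    (((hT y).const_sub μ).fun_pow 2).congr_deriv (by push_cast; ring)
  have hB (y : ℝ) : HasDerivAt (fun y : ℝ => -(1 - (Real.tanh y : ℂ) ^ 2))
      (2 * ((Real.tanh y : ℂ) * (1 - (Real.tanh y : ℂ) ^ 2))) y :=
    (((hT y).fun_pow 2).const_sub 1).fun_neg.congr_deriv (by push_cast; ring)
  have hS := ((hT x).fun_pow 2).const_sub 1
  rw [deriv_deriv_mul_exp hA ((((hT x).const_sub μ).fun_mul hS).const_mul (-2)),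
    deriv_deriv_mul_exp hB (((hT x).fun_mul hS).const_mul 2)]
  generalize Complex.exp (μ * (x : ℂ)) = E
  generalize (Real.tanh x : ℂ) = T
  push_cast
  constructor
  · linear_combination (-(μ - T) ^ 2 * E) * hμ
  · linear_combination ((1 - T ^ 2) * E) * hμ

/-- The four Jost-type solutions `f₁, g₂, f₃, g₄` solve `H(1)f = z f` pointwise on `ℝ`,
where `μ² = 1 − z` and `ν² = 1 + z`. -/
theorem jost_solutions (z μ ν : ℂ) (hμ : μ ^ 2 = 1 - z) (hν : ν ^ 2 = 1 + z) :
    SolvesH1 z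
      (fun x => (μ - (Real.tanh x : ℂ)) ^ 2 * Complex.exp (μ * (x : ℂ)))
      (fun x => -((sech x : ℝ) : ℂ) ^ 2 * Complex.exp (μ * (x : ℂ))) ∧
    SolvesH1 z
      (fun x => (μ + (Real.tanh x : ℂ)) ^ 2 * Complex.exp (-μ * (x : ℂ)))
      (fun x => -((sech x : ℝ) : ℂ) ^ 2 * Complex.exp (-μ * (x : ℂ))) ∧
    SolvesH1 z
      (fun x => -((sech x : ℝ) : ℂ) ^ 2 * Complex.exp (-ν * (x : ℂ)))
      (fun x => (ν + (Real.tanh x : ℂ)) ^ 2 * Complex.exp (-ν * (x : ℂ))) ∧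
    SolvesH1 z
      (fun x => -((sech x : ℝ) : ℂ) ^ 2 * Complex.exp (ν * (x : ℂ)))
      (fun x => (ν - (Real.tanh x : ℂ)) ^ 2 * Complex.exp (ν * (x : ℂ))) := by
  have sub_neg_sq (a b : ℂ) : (-a - b) ^ 2 = (a + b) ^ 2 := by ring
  refine ⟨solvesH1_tanh_exp z μ hμ, ?_, ?_, ?_⟩
  · simpa only [sub_neg_sq] using solvesH1_tanh_exp z (-μ) (by rw [neg_sq, hμ])
  · simpa only [sub_neg_sq] using
      (solvesH1_tanh_exp (-z) (-ν) (by rw [neg_sq, hν]; ring)).swap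
  · exact (solvesH1_tanh_exp (-z) ν (by rw [hν]; ring)).swap
end

section
/- Fix ω > 0 and let f : ℝ → ℂ be integrable. Define F̃₊(ξ) := ∫_ℝ ( f(x) · conj(Ψ₁,ω(x,ξ)) − conj(f(x)) · conj(Ψ₂,ω(x,ξ)) ) dx and F̃₋(ξ) := ∫_ℝ ( f(x) · conj(Ψ₂,ω(x,ξ)) − conj(f(x)) · conj(Ψ₁,ω(x,ξ)) ) dx. Then for every ξ ∈ ℝ, F̃₊(ξ) = − ( (|ξ| − i√ω)² / (|ξ| + i√ω)² ) · conj( F̃₋(−ξ) ). -/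
open MeasureTheory

/-- `Ψ₁,ω(x,ξ) = (2π)^{−1/2} (ξ + i√ω tanh(√ω x))² (|ξ| − i√ω)^{−2} e^{ixξ}`. -/
noncomputable def Psi1 (ω x ξ : ℝ) : ℂ :=
  ((Real.sqrt (2 * Real.pi) : ℝ) : ℂ)⁻¹ *
    ((ξ : ℂ) + Complex.I * ((Real.sqrt ω : ℝ) : ℂ) *
        ((Real.tanh (Real.sqrt ω * x) : ℝ) : ℂ)) ^ 2 /
      (((|ξ| : ℝ) : ℂ) - Complex.I * ((Real.sqrt ω : ℝ) : ℂ)) ^ 2 *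
    Complex.exp (Complex.I * x * ξ)

/-- `Ψ₂,ω(x,ξ) = (2π)^{−1/2} ω sech²(√ω x) (|ξ| − i√ω)^{−2} e^{ixξ}`. -/
noncomputable def Psi2 (ω x ξ : ℝ) : ℂ :=
  ((Real.sqrt (2 * Real.pi) : ℝ) : ℂ)⁻¹ *
    ((ω : ℂ) * ((sech (Real.sqrt ω * x) ^ 2 : ℝ) : ℂ)) /
      (((|ξ| : ℝ) : ℂ) - Complex.I * ((Real.sqrt ω : ℝ) : ℂ)) ^ 2 *
    Complex.exp (Complex.I * x * ξ)

/-- The component `F̃₊(ξ) = ∫ (f conj(Ψ₁,ω) − conj(f) conj(Ψ₂,ω)) dx` of the distorted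
Fourier transform of the vector `(f, conj f)`. -/
noncomputable def distFTplus (ω : ℝ) (f : ℝ → ℂ) (ξ : ℝ) : ℂ :=
  ∫ x : ℝ, (f x * starRingEnd ℂ (Psi1 ω x ξ) - starRingEnd ℂ (f x) * starRingEnd ℂ (Psi2 ω x ξ))

/-- The component `F̃₋(ξ) = ∫ (f conj(Ψ₂,ω) − conj(f) conj(Ψ₁,ω)) dx` of the distorted
Fourier transform of the vector `(f, conj f)`. -/
noncomputable def distFTminus (ω : ℝ) (f : ℝ → ℂ) (ξ : ℝ) : ℂ :=
  ∫ x : ℝ, (f x * starRingEnd ℂ (Psi2 ω x ξ) - starRingEnd ℂ (f x) * starRingEnd ℂ (Psi1 ω x ξ))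

lemma abs_sub_I_mul_sqrt_ne_zero {ω : ℝ} (hω : 0 < ω) (ξ : ℝ) :
    ((|ξ| : ℝ) : ℂ) - Complex.I * ((Real.sqrt ω : ℝ) : ℂ) ≠ 0 := by
  intro h
  have := congrArg Complex.im h
  simp at this
  exact (Real.sqrt_pos.2 hω).ne' this

lemma conj_Psi1 {ω : ℝ} (hω : 0 < ω) (x ξ : ℝ) :
    starRingEnd ℂ (Psi1 ω x ξ) =
      ((((|ξ| : ℝ) : ℂ) - Complex.I * ((Real.sqrt ω : ℝ) : ℂ)) ^ 2 /
        ((((|ξ| : ℝ) : ℂ) + Complex.I * ((Real.sqrt ω : ℝ) : ℂ)) ^ 2)) * Psi1 ω x (-ξ) := by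
  have h := abs_sub_I_mul_sqrt_ne_zero hω ξ
  simp only [Psi1, map_mul, map_div₀, map_pow, map_sub, map_add, map_inv₀, Complex.conj_ofReal,
    Complex.conj_I, ← Complex.exp_conj, abs_neg, Complex.ofReal_neg, neg_mul, mul_neg,
    sub_neg_eq_add]
  field_simp
  ring

lemma conj_Psi2 {ω : ℝ} (hω : 0 < ω) (x ξ : ℝ) :
    starRingEnd ℂ (Psi2 ω x ξ) =
      ((((|ξ| : ℝ) : ℂ) - Complex.I * ((Real.sqrt ω : ℝ) : ℂ)) ^ 2 /
        ((((|ξ| : ℝ) : ℂ) + Complex.I * ((Real.sqrt ω : ℝ) : ℂ)) ^ 2)) * Psi2 ω x (-ξ) := by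
  have h := abs_sub_I_mul_sqrt_ne_zero hω ξ
  simp only [Psi2, map_mul, map_div₀, map_pow, map_sub, map_inv₀, Complex.conj_ofReal,
    Complex.conj_I, ← Complex.exp_conj, abs_neg, Complex.ofReal_neg, neg_mul, mul_neg,
    sub_neg_eq_add]
  field_simp

/-- Relation between the two components of the distorted Fourier transform under complex
conjugation: `F̃₊(ξ) = −((|ξ| − i√ω)²/(|ξ| + i√ω)²) conj(F̃₋(−ξ))`. -/
theorem distFT_components_relation (ω : ℝ) (hω : 0 < ω) (f : ℝ → ℂ)
    (hf : Integrable f) (ξ : ℝ) :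
    distFTplus ω f ξ =
      -(((((|ξ| : ℝ) : ℂ) - Complex.I * ((Real.sqrt ω : ℝ) : ℂ)) ^ 2 /
          ((((|ξ| : ℝ) : ℂ) + Complex.I * ((Real.sqrt ω : ℝ) : ℂ)) ^ 2)) *
        starRingEnd ℂ (distFTminus ω f (-ξ))) := by
  rw [distFTplus, distFTminus, ← integral_conj, ← integral_const_mul, ← integral_neg]
  refine integral_congr_ae (.of_forall fun x => ?_)
  simp only [conj_Psi1 hω x ξ, conj_Psi2 hω x ξ, map_sub, map_mul, Complex.conj_conj]
  ring
end

section
/- Let δ ∈ (0, 1/30). There exists a constant C ≥ 1 (depending only on δ) with the following property. Let t ≥ 1, let ε̃ ∈ (0,1), and let g₁, g₂, g₃ : ℝ → ℂ be continuously differentiable with ‖g_j‖_{L^∞} + ‖⟨ξ⟩ g_j‖_{L²} ≤ ε̃ and ‖g_j′‖_{L²} ≤ ε̃ t^{δ} for j = 1,2,3. Define T(ξ) := ∬_{ℝ²} e^{2 i t σ η} g₁(ξ − σ) · conj(g₂(ξ − σ − η)) · g₃(ξ − η) dσ dη. Then for every ξ ∈ ℝ, | T(ξ) − (π/t) g₁(ξ)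 · conj(g₂(ξ)) · g₃(ξ) | ≤ C ε̃³ t^{−6/5 + 3δ}. -/
open MeasureTheory

/-- The Japanese bracket `⟨ξ⟩ = √(1 + ξ²)`. -/
noncomputable def jb (x : ℝ) : ℝ := Real.sqrt (1 + x ^ 2)

open scoped FourierTransform SchwartzMap ENNReal ContDiff

/-- A locally integrable function that pairs with Schwartz functions like the Fourier transform of
an `L²` function has the same `L²` norm as that function. -/
lemma eLpNorm_two_eq_of_integral_schwartz_eq {G h : ℝ → ℂ} (hG : LocallyIntegrable G)
    (hh : MemLp h 2) (H : ∀ φ : 𝓢(ℝ, ℂ), ∫ x, φ x * G x = ∫ x, 𝓕 (φ : ℝ → ℂ) x * h x) :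
    eLpNorm G 2 volume = eLpNorm h 2 volume := by
  have hae : G =ᵐ[volume] (𝓕 (hh.toLp h) : Lp ℂ 2 (volume : Measure ℝ)) := by
    refine ae_eq_of_integral_contDiff_smul_eq hG
      ((Lp.memLp _).locallyIntegrable (by norm_num)) fun g hg hgc => ?_
    have h₁ : HasCompactSupport (fun x => (g x : ℂ)) := hgc.comp_left Complex.ofReal_zero
    have h₂ : ContDiff ℝ ∞ (fun x => (g x : ℂ)) := Complex.ofRealCLM.contDiff.comp hg
    have key := congrArg (fun T : 𝓢'(ℝ, ℂ) => T (h₁.toSchwartzMap h₂))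
      (Lp.fourier_toTemperedDistribution_eq (hh.toLp h))
    simp only [TemperedDistribution.fourier_apply, Lp.toTemperedDistribution_apply] at key
    have e := H (h₁.toSchwartzMap h₂)
    calc ∫ x, g x • G x = ∫ x, (h₁.toSchwartzMap h₂) x * G x := by
          refine integral_congr_ae (.of_forall fun x => ?_)
          simp [Complex.real_smul]
      _ = _ := e
      _ = ∫ x, (𝓕 (h₁.toSchwartzMap h₂)) x • (hh.toLp h) x := by
          refine integral_congr_ae ?_
          filter_upwards [hh.coeFn_toLp] with x hx
          rw [hx, SchwartzMap.fourier_coe, smul_eq_mul]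
      _ = _ := key
      _ = _ := by
          refine integral_congr_ae (.of_forall fun x => ?_)
          simp [Complex.real_smul]
  rw [eLpNorm_congr_ae hae]
  have := Lp.norm_fourier_eq (hh.toLp h)
  rw [Lp.norm_def, Lp.norm_toLp] at this
  exact (ENNReal.toReal_eq_toReal_iff' (Lp.eLpNorm_ne_top _) hh.eLpNorm_ne_top).1 this

lemma continuous_fourier_of_integrable {f : ℝ → ℂ} (hf : Integrable f) : Continuous (𝓕 f) :=
  VectorFourier.fourierIntegral_continuous Real.continuous_fourierChar
    (innerSL ℝ).continuous₂ hf

lemma norm_fourier_le_integral_norm (f : ℝ → ℂ) (w : ℝ) : ‖𝓕 f w‖ ≤ ∫ x, ‖f x‖ :=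
  VectorFourier.norm_fourierIntegral_le_integral_norm _ _ _ _ _

lemma integral_schwartz_mul_fourier {f : ℝ → ℂ} (hf : Integrable f) {φ : ℝ → ℂ}
    (hφ : Integrable φ) : ∫ x, φ x * 𝓕 f x = ∫ x, 𝓕 φ x * f x := by
  have := VectorFourier.integral_fourierIntegral_smul_eq_flip (L := innerₗ ℝ)
    Real.continuous_fourierChar (innerSL ℝ).continuous₂ hφ hf (μ := volume) (ν := volume)
  simp only [flip_innerₗ, smul_eq_mul] at this
  exact this.symm

/-- Plancherel's theorem for integrable functions in `L²`. -/
lemma eLpNorm_two_fourier {f : ℝ → ℂ} (hf : Integrable f) (hf₂ : MemLp f 2) :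
    eLpNorm (𝓕 f) 2 volume = eLpNorm f 2 volume :=
  eLpNorm_two_eq_of_integral_schwartz_eq (continuous_fourier_of_integrable hf).locallyIntegrable
    hf₂ fun φ => integral_schwartz_mul_fourier hf φ.integrable

/-- Plancherel's theorem for the derivative. -/
lemma eLpNorm_two_mul_fourier {f : ℝ → ℂ} (hf : Integrable f) (hd : ContDiff ℝ 1 f)
    (hf' : MemLp (deriv f) 2) :
    eLpNorm (fun w : ℝ => (2 * Real.pi * Complex.I * w) * 𝓕 f w) 2 volume
      = eLpNorm (deriv f) 2 volume := by
  have hc := continuous_fourier_of_integrable hf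
  refine eLpNorm_two_eq_of_integral_schwartz_eq
    (Continuous.locallyIntegrable (by fun_prop)) hf' fun φ => ?_
  have hφ1 : Integrable (fun x : ℝ => x • φ x) := by
    refine (φ.integrable_pow_mul volume 1).mono' (by fun_prop) (.of_forall fun x => ?_)
    simp
  have hφ2 : Integrable (fun x : ℝ => (-2 * Real.pi * Complex.I * x) • φ x) := by
    refine (hφ1.const_mul (-2 * Real.pi * Complex.I)).congr (.of_forall fun x => ?_)
    simp only [Complex.real_smul, smul_eq_mul]; ring
  have hS : MemLp (𝓕 (φ : ℝ → ℂ)) 2 := by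
    rw [← SchwartzMap.fourier_coe]; exact (𝓕 φ).memLp 2
  have hSi : Integrable (𝓕 (φ : ℝ → ℂ)) := by
    rw [← SchwartzMap.fourier_coe]; exact (𝓕 φ).integrable
  calc ∫ x : ℝ, φ x * ((2 * Real.pi * Complex.I * x) * 𝓕 f x)
      = -∫ x : ℝ, ((-2 * Real.pi * Complex.I * x) • φ x) * 𝓕 f x := by
        rw [← integral_neg]
        refine integral_congr_ae (.of_forall fun x => ?_)
        simp only [smul_eq_mul]; ring
    _ = -∫ x, f x * 𝓕 (fun x : ℝ => (-2 * Real.pi * Complex.I * x) • φ x) x := by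
        rw [integral_schwartz_mul_fourier hf hφ2]
        simp only [mul_comm]
    _ = ∫ x, deriv f x * 𝓕 (φ : ℝ → ℂ) x := by
        rw [integral_mul_deriv_eq_deriv_mul_of_integrable (u' := deriv f) (v := 𝓕 (φ : ℝ → ℂ))
          (fun x _ => (hd.differentiable one_ne_zero x).hasDerivAt)
          (fun x _ => Real.hasDerivAt_fourier φ.integrable hφ1 x), neg_neg]
        · exact hf.mul_bdd (continuous_fourier_of_integrable hφ2).aestronglyMeasurable
            (.of_forall fun x => norm_fourier_le_integral_norm _ x)
        · exact hf'.integrable_mul hS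
        · exact hf.mul_bdd (continuous_fourier_of_integrable φ.integrable).aestronglyMeasurable
            (.of_forall fun x => norm_fourier_le_integral_norm _ x)
    _ = _ := by simp only [mul_comm]

lemma memLp_two_one_add_sq_rpow {r : ℝ} (hr : r < -(1 / 4)) :
    MemLp (fun w : ℝ => (1 + w ^ 2) ^ r) 2 := by
  have hc : Continuous fun w : ℝ => (1 + w ^ 2) ^ r :=
    Continuous.rpow_const (by fun_prop) fun w => .inl (by positivity)
  rw [memLp_two_iff_integrable_sq hc.aestronglyMeasurable]
  have := integrable_rpow_neg_one_add_norm_sq (E := ℝ) (μ := volume) (r := -4 * r)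
    (by simp; linarith)
  refine this.congr (.of_forall fun w => ?_)
  simp only [Real.norm_eq_abs, sq_abs]
  rw [← Real.rpow_mul_natCast (by positivity)]
  congr 1; push_cast; ring

/-- The Fourier transform of an `H¹` function has a weighted `L¹` bound. -/
lemma exists_integral_weight_mul_norm_fourier_le :
    ∃ K : ℝ, ∀ (f : ℝ → ℂ) (B : ℝ), 0 ≤ B → Integrable f → ContDiff ℝ 1 f →
      eLpNorm f 2 volume ≤ ENNReal.ofReal B → eLpNorm (deriv f) 2 volume ≤ ENNReal.ofReal B →
      Integrable (fun w : ℝ => (1 + w ^ 2) ^ (1 / 5 : ℝ) * ‖𝓕 f w‖) ∧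
        ∫ w : ℝ, (1 + w ^ 2) ^ (1 / 5 : ℝ) * ‖𝓕 f w‖ ≤ K * B := by
  have hφ := memLp_two_one_add_sq_rpow (r := -(3 / 10)) (by norm_num)
  set φ : ℝ → ℝ := fun w => (1 + w ^ 2) ^ (-(3 / 10) : ℝ) with hφ_def
  refine ⟨(eLpNorm φ 2 volume).toReal * 2, fun f B hB hf hd h2 h2' => ?_⟩
  have hm : MemLp f 2 := ⟨hf.1, h2.trans_lt ENNReal.ofReal_lt_top⟩
  have hm' : MemLp (deriv f) 2 :=
    ⟨(hd.continuous_deriv le_rfl).aestronglyMeasurable, h2'.trans_lt ENNReal.ofReal_lt_top⟩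
  have hc := continuous_fourier_of_integrable hf
  set H : ℝ → ℝ := fun w => ‖𝓕 f w‖ + ‖(2 * Real.pi * Complex.I * w) * 𝓕 f w‖ with hH_def
  have hHc : Continuous H := by fun_prop
  have hH : eLpNorm H 2 volume ≤ ENNReal.ofReal (2 * B) := by
    calc eLpNorm H 2 volume ≤ eLpNorm (fun w => ‖𝓕 f w‖) 2 volume +
          eLpNorm (fun w : ℝ => ‖(2 * Real.pi * Complex.I * w) * 𝓕 f w‖) 2 volume :=
        eLpNorm_add_le (by fun_prop) (by fun_prop) (by norm_num)
      _ ≤ ENNReal.ofReal B + ENNReal.ofReal B := by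
        rw [eLpNorm_norm, eLpNorm_norm, eLpNorm_two_fourier hf hm,
          eLpNorm_two_mul_fourier hf hd hm']
        gcongr
      _ = ENNReal.ofReal (2 * B) := by rw [← ENNReal.ofReal_add hB hB, two_mul]
  have hHm : MemLp H 2 := ⟨by fun_prop, hH.trans_lt ENNReal.ofReal_lt_top⟩
  have hint : Integrable (φ * H) := hφ.integrable_mul hHm
  have hle : ∀ w : ℝ, (1 + w ^ 2) ^ (1 / 5 : ℝ) * ‖𝓕 f w‖ ≤ (φ * H) w := fun w => by
    have h1 : (1 + w ^ 2) ^ (1 / 5 : ℝ) = φ w * √(1 + w ^ 2) := by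
      rw [hφ_def, Real.sqrt_eq_rpow, ← Real.rpow_add (by positivity)]; norm_num
    have h2 : √(1 + w ^ 2) ≤ 1 + 2 * Real.pi * |w| := by
      refine Real.sqrt_le_iff.2 ⟨by positivity, ?_⟩
      have := sq_abs w
      have hp := Real.pi_gt_three
      nlinarith [abs_nonneg w, mul_nonneg (abs_nonneg w) Real.pi_pos.le,
        mul_self_le_mul_self (abs_nonneg w) (show |w| ≤ 2 * Real.pi * |w| by
          nlinarith [abs_nonneg w])]
    have h3 : H w = (1 + 2 * Real.pi * |w|) * ‖𝓕 f w‖ := by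
      simp [hH_def, abs_of_pos Real.pi_pos]; ring
    rw [h1, Pi.mul_apply, h3, mul_assoc]
    have : 0 ≤ φ w := by positivity
    gcongr
  have hwc : Continuous fun w : ℝ => (1 + w ^ 2) ^ (1 / 5 : ℝ) * ‖𝓕 f w‖ :=
    (Continuous.rpow_const (by fun_prop) fun w => .inl (by positivity)).mul hc.norm
  have hI : Integrable (fun w : ℝ => (1 + w ^ 2) ^ (1 / 5 : ℝ) * ‖𝓕 f w‖) :=
    hint.mono' hwc.aestronglyMeasurable (.of_forall fun w => by
      rw [Real.norm_of_nonneg (by positivity)]; exact hle w)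
  refine ⟨hI, (integral_mono hI hint hle).trans ?_⟩
  calc ∫ w, (φ * H) w = ∫ w, ‖(φ * H) w‖ := by
        refine integral_congr_ae (.of_forall fun w => ?_)
        simp only
        rw [Real.norm_of_nonneg]
        exact le_trans (by positivity) (hle w)
    _ = (eLpNorm (φ * H) 1 volume).toReal := by
        rw [eLpNorm_one_eq_lintegral_enorm, integral_norm_eq_lintegral_enorm hint.1]
    _ ≤ (eLpNorm φ 2 volume * ENNReal.ofReal (2 * B)).toReal := by
        refine ENNReal.toReal_mono (by finiteness [hφ.eLpNorm_ne_top]) ?_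
        exact (eLpNorm_smul_le_mul_eLpNorm hHm.1 hφ.1).trans (by gcongr)
    _ = _ := by
        rw [ENNReal.toReal_mul, ENNReal.toReal_ofReal (by positivity), mul_assoc]

lemma integrable_of_memLp_two_jb_mul {g : ℝ → ℂ}
    (h : MemLp (fun x : ℝ => ((jb x : ℝ) : ℂ) * g x) 2) : Integrable g := by
  have h1 : MemLp (fun x : ℝ => (((1 + x ^ 2) ^ (-(1 / 2) : ℝ) : ℝ) : ℂ)) 2 :=
    (memLp_two_one_add_sq_rpow (by norm_num)).ofReal
  refine (h1.integrable_mul h).congr (.of_forall fun x => ?_)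
  have h2 : (1 + x ^ 2) ^ (-(1 / 2) : ℝ) * jb x = 1 := by
    rw [jb, Real.sqrt_eq_rpow, ← Real.rpow_add (by positivity)]; norm_num
  simp only [Pi.mul_apply]
  rw [← mul_assoc, ← Complex.ofReal_mul, h2, Complex.ofReal_one, one_mul]

lemma norm_le_abs_jb_mul (g : ℝ → ℂ) (x : ℝ) : ‖g x‖ ≤ ‖((jb x : ℝ) : ℂ) * g x‖ := by
  have : 1 ≤ jb x := Real.one_le_sqrt.2 (by nlinarith [sq_nonneg x])
  rw [norm_mul, Complex.norm_real, Real.norm_of_nonneg (by linarith)]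
  nlinarith [norm_nonneg (g x)]

lemma norm_le_of_eLpNorm_top_le {f : ℝ → ℂ} (hf : Continuous f) {B : ℝ} (hB : 0 ≤ B)
    (h : eLpNorm f ⊤ volume ≤ ENNReal.ofReal B) (x : ℝ) : ‖f x‖ ≤ B := by
  have hae : ∀ᵐ x, ‖f x‖ ≤ B := by
    rw [eLpNorm_exponent_top] at h
    filter_upwards [enorm_ae_le_eLpNormEssSup f volume] with x hx
    exact (ENNReal.ofReal_le_ofReal_iff hB).1 (by rw [ofReal_norm]; exact hx.trans h)
  have hcl : IsClosed {x | ‖f x‖ ≤ B} := isClosed_le hf.norm continuous_const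
  have := (Measure.dense_of_ae hae).closure_eq
  rw [hcl.closure_eq] at this
  exact this.symm.subset (Set.mem_univ x)

/-- An `H¹` function on the line is Hölder continuous of exponent `1/2`. -/
lemma norm_sub_le_sqrt_mul {f : ℝ → ℂ} (hd : ContDiff ℝ 1 f) {B : ℝ} (hB : 0 ≤ B)
    (h : eLpNorm (deriv f) 2 volume ≤ ENNReal.ofReal B) (s : ℝ) :
    ‖f s - f 0‖ ≤ √|s| * B := by
  have hc := hd.continuous_deriv le_rfl
  rw [← intervalIntegral.integral_deriv_eq_sub
    (fun x _ => hd.differentiable one_ne_zero x) (hc.intervalIntegrable _ _)]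
  refine intervalIntegral.norm_integral_le_integral_norm_uIoc.trans ?_
  have hi : IntegrableOn (deriv f) (Set.uIoc 0 s) := (hc.intervalIntegrable 0 s).def'
  rw [integral_norm_eq_lintegral_enorm hi.1, ← eLpNorm_one_eq_lintegral_enorm]
  have hs := eLpNorm_le_eLpNorm_mul_rpow_measure_univ (p := 1) (q := 2) (by norm_num) hi.1
  rw [Measure.restrict_apply_univ, Set.uIoc, Real.volume_Ioc, max_sub_min_eq_abs, sub_zero] at hs
  norm_num at hs
  rw [ENNReal.ofReal_rpow_of_nonneg (abs_nonneg s) (by norm_num)] at hs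
  refine (ENNReal.toReal_mono (by finiteness) (hs.trans
    (mul_le_mul_left ((eLpNorm_restrict_le _ _ _ _).trans h) _))).trans_eq ?_
  rw [ENNReal.toReal_mul, ENNReal.toReal_ofReal hB, ENNReal.toReal_ofReal (by positivity),
    mul_comm, Real.sqrt_eq_rpow]

lemma conj_eq_integral_conj_fourier {f : ℝ → ℂ} (hc : Continuous f) (hf : Integrable f)
    (hF : Integrable (𝓕 f)) (x : ℝ) :
    starRingEnd ℂ (f x) =
      ∫ w : ℝ, Complex.exp (-2 * Real.pi * Complex.I * x * w) * starRingEnd ℂ (𝓕 f w) := by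
  have h : f x = ∫ w : ℝ, Complex.exp (2 * Real.pi * Complex.I * x * w) * 𝓕 f w := by
    conv_lhs => rw [← hc.fourierInv_fourier_eq hf hF, Real.fourierInv_eq']
    refine integral_congr_ae (.of_forall fun w => ?_)
    simp only [RCLike.inner_apply, conj_trivial, smul_eq_mul]
    congr 2; push_cast; ring
  rw [h, ← integral_conj]
  refine integral_congr_ae (.of_forall fun w => ?_)
  simp only [map_mul, ← Complex.exp_conj, Complex.conj_ofReal, Complex.conj_I, map_ofNat]
  congr 2; ring

lemma integral_phase_mul_eq_fourier (f : ℝ → ℂ) (t y w : ℝ) :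
    ∫ x : ℝ, Complex.exp (2 * Complex.I * t * x * y) *
      Complex.exp (-2 * Real.pi * Complex.I * x * w) * f x = 𝓕 f (w - t / Real.pi * y) := by
  rw [Real.fourier_real_eq_integral_exp_smul]
  refine integral_congr_ae (.of_forall fun x => ?_)
  have hp : (Real.pi : ℂ) ≠ 0 := by exact_mod_cast Real.pi_ne_zero
  simp only [smul_eq_mul, ← Complex.exp_add]
  congr 2
  push_cast
  field_simp
  ring

lemma integral_eq_mul_integral_sub_left (h : ℝ → ℂ) {a : ℝ} (ha : 0 < a) (w : ℝ) :
    ∫ y, h y = a * ∫ u, h (a * (w - u)) := by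
  rw [integral_sub_left_eq_self (fun v => h (a * v)) volume w, Measure.integral_comp_mul_left,
    abs_of_pos (inv_pos.2 ha), Complex.real_smul, ← mul_assoc, ← Complex.ofReal_mul,
    mul_inv_cancel₀ ha.ne', Complex.ofReal_one, one_mul]

/-- The trilinear oscillatory integral, written on the Fourier side of its first two factors. -/
lemma integral_trilinear_eq {f₁ f₂ f₃ : ℝ → ℂ} (hc₂ : Continuous f₂)
    (h₁ : Integrable f₁) (h₂ : Integrable f₂) (h₃ : Integrable f₃) (hF₂ : Integrable (𝓕 f₂))
    {t : ℝ} (ht : 0 < t) :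
    ∫ p : ℝ × ℝ, Complex.exp (2 * Complex.I * t * p.1 * p.2) * f₁ p.1 *
        starRingEnd ℂ (f₂ (p.1 + p.2)) * f₃ p.2 =
      ((Real.pi / t : ℝ) : ℂ) * ∫ w : ℝ, starRingEnd ℂ (𝓕 f₂ w) * ∫ u : ℝ, 𝓕 f₁ u *
        (Complex.exp (-2 * Real.pi * Complex.I * ((Real.pi / t * (w - u) : ℝ) : ℂ) * w) *
          f₃ (Real.pi / t * (w - u))) := by
  set Φ : ℝ × ℝ → ℝ → ℂ := fun p w => Complex.exp (2 * Complex.I * t * p.1 * p.2) *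
    Complex.exp (-2 * Real.pi * Complex.I * ((p.1 + p.2 : ℝ) : ℂ) * w) *
    (f₁ p.1 * f₃ p.2 * starRingEnd ℂ (𝓕 f₂ w)) with hΦ
  have hF₂' : Integrable fun w => starRingEnd ℂ (𝓕 f₂ w) :=
    hF₂.congr' (Complex.continuous_conj.comp_aestronglyMeasurable hF₂.1)
      (.of_forall fun w => (RCLike.norm_conj _).symm)
  have hphase : ∀ a b c d : ℝ, ‖Complex.exp (2 * Complex.I * t * a * b) *
      Complex.exp (-2 * Real.pi * Complex.I * (c : ℂ) * d)‖ = 1 := fun a b c d => by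
    rw [norm_mul, Complex.norm_exp, Complex.norm_exp]; simp
  have hΦi : Integrable (Function.uncurry Φ) (volume.prod volume) := by
    refine ((h₁.mul_prod h₃).mul_prod hF₂').bdd_mul (c := 1)
      (Continuous.aestronglyMeasurable (by fun_prop)) (.of_forall fun q => ?_)
    exact (hphase _ _ _ _).le
  have hΦw : ∀ w, Integrable (fun p => Φ p w) (volume.prod volume) := fun w => by
    refine ((h₁.mul_prod h₃).mul_const _).bdd_mul (c := 1)
      (Continuous.aestronglyMeasurable (by fun_prop)) (.of_forall fun q => ?_)
    exact (hphase _ _ _ _).le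
  calc _ = ∫ p : ℝ × ℝ, ∫ w, Φ p w := by
        refine integral_congr_ae (.of_forall fun p => ?_)
        simp only [hΦ]
        rw [conj_eq_integral_conj_fourier hc₂ h₂ hF₂, ← integral_const_mul, ← integral_mul_const]
        refine integral_congr_ae (.of_forall fun w => ?_)
        simp only
        ring
    _ = ∫ w, ∫ p : ℝ × ℝ, Φ p w := integral_integral_swap hΦi
    _ = _ := by
        rw [← integral_const_mul]
        refine integral_congr_ae (.of_forall fun w => ?_)
        simp only
        rw [Measure.volume_eq_prod, integral_prod_symm _ (hΦw w)]
        have hin : ∀ y, ∫ x, Φ (x, y) w = starRingEnd ℂ (𝓕 f₂ w) *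
            (𝓕 f₁ (w - t / Real.pi * y) *
              (Complex.exp (-2 * Real.pi * Complex.I * (y : ℂ) * w) * f₃ y)) := fun y => by
          rw [← integral_phase_mul_eq_fourier f₁ t, ← integral_mul_const, ← integral_const_mul]
          refine integral_congr_ae (.of_forall fun x => ?_)
          have : Complex.exp (-2 * Real.pi * Complex.I * ((x + y : ℝ) : ℂ) * w) =
              Complex.exp (-2 * Real.pi * Complex.I * x * w) *
                Complex.exp (-2 * Real.pi * Complex.I * y * w) := by
            rw [← Complex.exp_add]; congr 1; push_cast; ring
          simp only [hΦ, this]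
          ring
        simp only [hin]
        rw [integral_const_mul, integral_eq_mul_integral_sub_left _ (div_pos Real.pi_pos ht) w,
          mul_left_comm]
        congr 2
        refine integral_congr_ae (.of_forall fun u => ?_)
        have : w - t / Real.pi * (Real.pi / t * (w - u)) = u := by
          have := Real.pi_ne_zero
          field_simp; ring
        simp only [this]

lemma min_one_le_rpow {x r : ℝ} (hx : 0 ≤ x) (hr : 0 ≤ r) (hr' : r ≤ 1) : min 1 x ≤ x ^ r := by
  rcases le_total x 1 with h | h
  · exact (min_le_right _ _).trans (Real.self_le_rpow_of_le_one hx h hr')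
  · exact (min_le_left _ _).trans (Real.one_le_rpow h hr)

lemma norm_exp_mul_sub_le {f : ℝ → ℂ} (hd : ContDiff ℝ 1 f) {ε A : ℝ} (hε : 0 ≤ ε) (hA : 1 ≤ A)
    (hf : ∀ x, ‖f x‖ ≤ ε) (hf' : eLpNorm (deriv f) 2 volume ≤ ENNReal.ofReal (ε * A))
    {s w Q : ℝ} (hs : |s| ≤ Q) (hsw : |2 * Real.pi * s * w| ≤ Q) :
    ‖Complex.exp (-2 * Real.pi * Complex.I * (s : ℂ) * w) * f s - f 0‖ ≤
      4 * ε * A * Q ^ (1 / 5 : ℝ) := by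
  have hQ : 0 ≤ Q := (abs_nonneg s).trans hs
  set e := Complex.exp (-2 * Real.pi * Complex.I * (s : ℂ) * w) with he
  have he_norm : ‖e‖ = 1 := by rw [he, Complex.norm_exp]; simp
  have h1 : ‖f s - f 0‖ ≤ 2 * ε * A * Q ^ (1 / 5 : ℝ) := by
    have a1 : ‖f s - f 0‖ ≤ 2 * ε * A := by
      have := norm_sub_le (f s) (f 0)
      nlinarith [hf s, hf 0]
    have a2 : ‖f s - f 0‖ ≤ 2 * ε * A * √Q := by
      refine (norm_sub_le_sqrt_mul hd (by positivity) hf' s).trans ?_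
      have : √|s| ≤ √Q := Real.sqrt_le_sqrt hs
      have h3 : 0 ≤ ε * A := by positivity
      nlinarith [Real.sqrt_nonneg Q, mul_le_mul_of_nonneg_right this h3,
        mul_nonneg h3 (Real.sqrt_nonneg Q)]
    calc _ ≤ 2 * ε * A * min 1 √Q := by
          rw [mul_min_of_nonneg _ _ (by positivity), mul_one]; exact le_min a1 a2
      _ ≤ 2 * ε * A * Q ^ (1 / 5 : ℝ) := by
          gcongr
          refine (min_one_le_rpow (Real.sqrt_nonneg Q) (r := 2 / 5) (by norm_num)
            (by norm_num)).trans_eq ?_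
          rw [Real.sqrt_eq_rpow, ← Real.rpow_mul hQ]; norm_num
  have h2 : ‖e - 1‖ ≤ 2 * Q ^ (1 / 5 : ℝ) := by
    have a1 : ‖e - 1‖ ≤ 2 := (norm_sub_le _ _).trans (by rw [he_norm, norm_one]; norm_num)
    have a2 : ‖e - 1‖ ≤ 2 * Q := by
      have := Real.norm_exp_I_mul_ofReal_sub_one_le (x := -(2 * Real.pi * s * w))
      rw [norm_neg, Real.norm_eq_abs] at this
      have h3 : e = Complex.exp (Complex.I * ((-(2 * Real.pi * s * w) : ℝ) : ℂ)) := by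
        rw [he]; congr 1; push_cast; ring
      rw [h3]; linarith
    calc _ ≤ 2 * min 1 Q := by
          rw [mul_min_of_nonneg _ _ (by positivity), mul_one]; exact le_min a1 a2
      _ ≤ _ := by gcongr; exact min_one_le_rpow hQ (by norm_num) (by norm_num)
  calc ‖e * f s - f 0‖ = ‖e * (f s - f 0) + (e - 1) * f 0‖ := by congr 1; ring
    _ ≤ ‖f s - f 0‖ + ‖e - 1‖ * ‖f 0‖ := by
        refine (norm_add_le _ _).trans ?_
        rw [norm_mul, norm_mul, he_norm, one_mul]
    _ ≤ 2 * ε * A * Q ^ (1 / 5 : ℝ) + 2 * Q ^ (1 / 5 : ℝ) * ε := by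
        gcongr; exact hf 0
    _ ≤ _ := by
        have : 0 ≤ ε * Q ^ (1 / 5 : ℝ) := by positivity
        nlinarith

lemma norm_trilinear_sub_le {f₁ f₂ f₃ : ℝ → ℂ} {ε A K t : ℝ} (hε : 0 ≤ ε) (hA : 1 ≤ A)
    (ht : 1 ≤ t) (hc₁ : Continuous f₁) (hc₂ : Continuous f₂) (hd₃ : ContDiff ℝ 1 f₃)
    (h₁ : Integrable f₁) (h₂ : Integrable f₂) (h₃ : Integrable f₃)
    (hw₁ : Integrable (fun w : ℝ => (1 + w ^ 2) ^ (1 / 5 : ℝ) * ‖𝓕 f₁ w‖))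
    (hw₂ : Integrable (fun w : ℝ => (1 + w ^ 2) ^ (1 / 5 : ℝ) * ‖𝓕 f₂ w‖))
    (hK₁ : ∫ w : ℝ, (1 + w ^ 2) ^ (1 / 5 : ℝ) * ‖𝓕 f₁ w‖ ≤ K * (ε * A))
    (hK₂ : ∫ w : ℝ, (1 + w ^ 2) ^ (1 / 5 : ℝ) * ‖𝓕 f₂ w‖ ≤ K * (ε * A))
    (hf₃ : ∀ x, ‖f₃ x‖ ≤ ε) (hf₃' : eLpNorm (deriv f₃) 2 volume ≤ ENNReal.ofReal (ε * A)) :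
    ‖(∫ p : ℝ × ℝ, Complex.exp (2 * Complex.I * t * p.1 * p.2) * f₁ p.1 *
        starRingEnd ℂ (f₂ (p.1 + p.2)) * f₃ p.2) -
      ((Real.pi / t : ℝ) : ℂ) * f₁ 0 * starRingEnd ℂ (f₂ 0) * f₃ 0‖ ≤
      4 * Real.pi * (2 * Real.pi ^ 2) ^ (1 / 5 : ℝ) * K ^ 2 * ε ^ 3 *
        (t ^ (-(6 : ℝ) / 5) * A ^ 3) := by
  have hπ := Real.pi_gt_three
  have ht0 : 0 < t := by linarith
  have hF : ∀ {f : ℝ → ℂ}, Integrable f →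
      Integrable (fun w : ℝ => (1 + w ^ 2) ^ (1 / 5 : ℝ) * ‖𝓕 f w‖) → Integrable (𝓕 f) :=
    fun {f} hf hw => hw.mono' (continuous_fourier_of_integrable hf).aestronglyMeasurable
      (.of_forall fun w => le_mul_of_one_le_left (norm_nonneg _)
        (Real.one_le_rpow (by nlinarith [sq_nonneg w]) (by norm_num)))
  have hF₁ := hF h₁ hw₁
  have hF₂ := hF h₂ hw₂
  set e : ℝ → ℝ → ℂ := fun w u =>
    Complex.exp (-2 * Real.pi * Complex.I * ((Real.pi / t * (w - u) : ℝ) : ℂ) * w) *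
      f₃ (Real.pi / t * (w - u)) with he
  set R : ℝ := 4 * ε * A * ((2 * Real.pi ^ 2) ^ (1 / 5 : ℝ) * t ^ (-(1 : ℝ) / 5)) with hR
  have hR0 : 0 ≤ R := by positivity
  have hb : ∀ w u, ‖e w u - f₃ 0‖ ≤
      R * ((1 + w ^ 2) ^ (1 / 5 : ℝ) * (1 + u ^ 2) ^ (1 / 5 : ℝ)) := fun w u => by
    have hwu : |w - u| ≤ (1 + w ^ 2) * (1 + u ^ 2) := by
      refine abs_le_of_sq_le_sq ?_ (by positivity)
      nlinarith [sq_nonneg (1 + w * u), sq_nonneg w, sq_nonneg u,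
        mul_nonneg (sq_nonneg w) (sq_nonneg u)]
    have hwuw : |w - u| * |w| ≤ (1 + w ^ 2) * (1 + u ^ 2) := by
      rw [← abs_mul, abs_le]
      constructor <;> nlinarith [sq_nonneg (w - u), sq_nonneg (w + u),
        mul_nonneg (sq_nonneg w) (sq_nonneg u)]
    have hP : 0 ≤ (1 + w ^ 2) * (1 + u ^ 2) := by positivity
    have hs : |Real.pi / t * (w - u)| ≤ 2 * Real.pi ^ 2 / t * ((1 + w ^ 2) * (1 + u ^ 2)) := by
      rw [abs_mul, abs_of_pos (by positivity)]
      gcongr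
      nlinarith
    have hsw : |2 * Real.pi * (Real.pi / t * (w - u)) * w| ≤
        2 * Real.pi ^ 2 / t * ((1 + w ^ 2) * (1 + u ^ 2)) := by
      have : 2 * Real.pi * (Real.pi / t * (w - u)) * w =
          2 * Real.pi ^ 2 / t * ((w - u) * w) := by ring
      rw [this, abs_mul, abs_of_pos (by positivity), abs_mul]
      gcongr
    refine (norm_exp_mul_sub_le hd₃ hε hA hf₃ hf₃' hs hsw).trans_eq ?_
    rw [Real.mul_rpow (by positivity) hP, Real.div_rpow (by positivity) ht0.le,
      Real.mul_rpow (x := 1 + w ^ 2) (by positivity) (by positivity), hR, neg_div, Real.rpow_neg ht0.le]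
    ring
  have hec : ∀ w, Continuous (e w) := fun w => by
    have := hd₃.continuous
    fun_prop
  have heb : ∀ w u, ‖e w u‖ ≤ ε := fun w u => by
    rw [he, norm_mul, Complex.norm_exp]; simpa using hf₃ _
  have hi₁ : ∀ w, Integrable (fun u => 𝓕 f₁ u * e w u) := fun w =>
    hF₁.mul_bdd (hec w).aestronglyMeasurable (.of_forall (heb w))
  have h0 : f₁ 0 = ∫ u, 𝓕 f₁ u := by
    have := conj_eq_integral_conj_fourier hc₁ h₁ hF₁ 0
    simp only [Complex.ofReal_zero, mul_zero, zero_mul, Complex.exp_zero, one_mul,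
      integral_conj] at this
    exact (starRingEnd ℂ).injective this
  have h0' : starRingEnd ℂ (f₂ 0) = ∫ w, starRingEnd ℂ (𝓕 f₂ w) := by
    simpa using conj_eq_integral_conj_fourier hc₂ h₂ hF₂ 0
  set D : ℝ → ℂ := fun w => ∫ u, 𝓕 f₁ u * (e w u - f₃ 0) with hD
  have hDb : ∀ w, ‖D w‖ ≤ R * (1 + w ^ 2) ^ (1 / 5 : ℝ) * (K * (ε * A)) := fun w => by
    refine (norm_integral_le_of_norm_le (hw₁.const_mul (R * (1 + w ^ 2) ^ (1 / 5 : ℝ)))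
      (.of_forall fun u => ?_)).trans ?_
    · rw [norm_mul]
      nlinarith [mul_le_mul_of_nonneg_left (hb w u) (norm_nonneg (𝓕 f₁ u))]
    · rw [integral_const_mul]
      gcongr
  have hDe : ∀ w, D w = (∫ u, 𝓕 f₁ u * e w u) - f₁ 0 * f₃ 0 := fun w => by
    rw [h0, ← integral_mul_const, ← integral_sub (hi₁ w) (hF₁.mul_const _)]
    simp only [hD, mul_sub]
  have hF₂' : Integrable fun w => starRingEnd ℂ (𝓕 f₂ w) :=
    hF₂.congr' (Complex.continuous_conj.comp_aestronglyMeasurable hF₂.1)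
      (.of_forall fun w => (RCLike.norm_conj _).symm)
  have hJ : Integrable fun w => starRingEnd ℂ (𝓕 f₂ w) * ∫ u, 𝓕 f₁ u * e w u := by
    refine hF₂'.mul_bdd (c := ∫ u, ‖𝓕 f₁ u‖ * ε) ?_ (.of_forall fun w => ?_)
    · refine Continuous.aestronglyMeasurable (continuous_of_dominated
        (bound := fun u => ‖𝓕 f₁ u‖ * ε) (fun w => (hi₁ w).1) (fun w => .of_forall fun u => ?_)
        (hF₁.norm.mul_const _) (.of_forall fun u => ?_))
      · rw [norm_mul]; gcongr; exact heb w u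
      · have := hd₃.continuous
        fun_prop
    · refine norm_integral_le_of_norm_le (hF₁.norm.mul_const _) (.of_forall fun u => ?_)
      rw [norm_mul]; gcongr; exact heb w u
  have key : (∫ p : ℝ × ℝ, Complex.exp (2 * Complex.I * t * p.1 * p.2) * f₁ p.1 *
        starRingEnd ℂ (f₂ (p.1 + p.2)) * f₃ p.2) -
      ((Real.pi / t : ℝ) : ℂ) * f₁ 0 * starRingEnd ℂ (f₂ 0) * f₃ 0 =
      ((Real.pi / t : ℝ) : ℂ) * ∫ w, starRingEnd ℂ (𝓕 f₂ w) * D w := by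
    have hT : ∫ p : ℝ × ℝ, Complex.exp (2 * Complex.I * t * p.1 * p.2) * f₁ p.1 *
        starRingEnd ℂ (f₂ (p.1 + p.2)) * f₃ p.2 =
        ((Real.pi / t : ℝ) : ℂ) * ∫ w, starRingEnd ℂ (𝓕 f₂ w) * ∫ u, 𝓕 f₁ u * e w u :=
      integral_trilinear_eq hc₂ h₁ h₂ h₃ hF₂ ht0
    have hDJ : ∫ w, starRingEnd ℂ (𝓕 f₂ w) * D w =
        (∫ w, starRingEnd ℂ (𝓕 f₂ w) * ∫ u, 𝓕 f₁ u * e w u) -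
          starRingEnd ℂ (f₂ 0) * (f₁ 0 * f₃ 0) := by
      rw [h0', ← integral_mul_const, ← integral_sub hJ (hF₂'.mul_const _)]
      simp only [hDe, mul_sub]
    rw [hT, hDJ]
    ring
  have hfin : ‖∫ w, starRingEnd ℂ (𝓕 f₂ w) * D w‖ ≤ R * (K * (ε * A)) * (K * (ε * A)) := by
    have hK0 : 0 ≤ K * (ε * A) :=
      (integral_nonneg fun w => by positivity).trans hK₁
    refine (norm_integral_le_of_norm_le (hw₂.const_mul (R * (K * (ε * A))))
      (.of_forall fun w => ?_)).trans ?_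
    · rw [norm_mul, RCLike.norm_conj]
      nlinarith [mul_le_mul_of_nonneg_left (hDb w) (norm_nonneg (𝓕 f₂ w))]
    · rw [integral_const_mul]
      gcongr
  rw [key, norm_mul, Complex.norm_real, Real.norm_of_nonneg (by positivity)]
  refine (mul_le_mul_of_nonneg_left hfin (by positivity)).trans_eq ?_
  have htp : t ^ (-(6 : ℝ) / 5) = t⁻¹ * t ^ (-(1 : ℝ) / 5) := by
    rw [← Real.rpow_neg_one, ← Real.rpow_add ht0]; norm_num
  rw [htp, hR]
  field_simp

lemma deriv_comp_const_sub_eq (g : ℝ → ℂ) (ξ : ℝ) :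
    deriv (fun x => g (ξ - x)) = fun x => -deriv g (ξ - x) :=
  funext fun x => deriv_comp_const_sub (f := g) ξ x

lemma eLpNorm_comp_const_sub {g : ℝ → ℂ} (hg : Continuous g) (p : ℝ≥0∞) (ξ : ℝ) :
    eLpNorm (fun x => g (ξ - x)) p volume = eLpNorm g p volume :=
  eLpNorm_comp_measurePreserving hg.aestronglyMeasurable
    (Measure.measurePreserving_sub_left volume ξ)

/-- The reflected translate `x ↦ g (ξ - x)` inherits all the bounds on `g`. -/
lemma bounds_comp_const_sub {g : ℝ → ℂ} {ε A : ℝ} (hε : 0 ≤ ε) (hA : 1 ≤ A)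
    (hd : ContDiff ℝ 1 g)
    (h : eLpNorm g ⊤ volume + eLpNorm (fun ξ : ℝ => ((jb ξ : ℝ) : ℂ) * g ξ) 2 volume
      ≤ ENNReal.ofReal ε)
    (h' : eLpNorm (deriv g) 2 volume ≤ ENNReal.ofReal (ε * A)) (ξ : ℝ) :
    ContDiff ℝ 1 (fun x => g (ξ - x)) ∧ Integrable (fun x => g (ξ - x)) ∧
      (∀ x, ‖g (ξ - x)‖ ≤ ε) ∧
      eLpNorm (fun x => g (ξ - x)) 2 volume ≤ ENNReal.ofReal (ε * A) ∧
      eLpNorm (deriv fun x => g (ξ - x)) 2 volume ≤ ENNReal.ofReal (ε * A) := by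
  have hjb : Continuous jb := by unfold jb; fun_prop
  have hc := hd.continuous
  have hw := le_add_self.trans h
  refine ⟨hd.comp (contDiff_const.sub contDiff_id), ?_,
    fun x => norm_le_of_eLpNorm_top_le hc hε (le_self_add.trans h) _, ?_, ?_⟩
  · exact (integrable_of_memLp_two_jb_mul ⟨Continuous.aestronglyMeasurable (by fun_prop),
      hw.trans_lt ENNReal.ofReal_lt_top⟩).comp_sub_left ξ
  · rw [eLpNorm_comp_const_sub hc]
    exact (eLpNorm_mono (norm_le_abs_jb_mul g)).trans
      (hw.trans (ENNReal.ofReal_le_ofReal (le_mul_of_one_le_right hε hA)))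
  · rw [deriv_comp_const_sub_eq]
    have : eLpNorm (fun x => -deriv g (ξ - x)) 2 volume =
        eLpNorm (fun x => deriv g (ξ - x)) 2 volume := eLpNorm_neg _ _ _
    rwa [this, eLpNorm_comp_const_sub (hd.continuous_deriv le_rfl)]

/-- Stationary phase lemma identifying the leading-order contribution of the cubic
interactions with a Dirac kernel: for `δ ∈ (0, 1/30)` there is `C ≥ 1` (depending only on
`δ`) such that for all `t ≥ 1`, `ε̃ ∈ (0,1)`, and `g₁, g₂, g₃ ∈ C¹` with
`‖g_j‖_{L∞} + ‖⟨ξ⟩g_j‖_{L²} ≤ ε̃` and `‖g_j′‖_{L²} ≤ ε̃ t^δ`, and for every `ξ ∈ ℝ`,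
`|∬ e^{2itση} g₁(ξ−σ) conj(g₂(ξ−σ−η)) g₃(ξ−η) dσ dη − (π/t) g₁(ξ) conj(g₂(ξ)) g₃(ξ)|
  ≤ C ε̃³ t^{−6/5+3δ}`. -/
theorem stationary_phase_dirac_kernel (δ : ℝ) (hδ : 0 < δ) (hδ' : δ < 1 / 30) :
    ∃ C : ℝ, 1 ≤ C ∧
      ∀ t : ℝ, 1 ≤ t →
      ∀ eps : ℝ, 0 < eps → eps < 1 →
      ∀ g₁ g₂ g₃ : ℝ → ℂ,
        ContDiff ℝ 1 g₁ → ContDiff ℝ 1 g₂ → ContDiff ℝ 1 g₃ →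
        (eLpNorm g₁ ⊤ volume +
            eLpNorm (fun ξ : ℝ => ((jb ξ : ℝ) : ℂ) * g₁ ξ) 2 volume ≤ ENNReal.ofReal eps) →
        (eLpNorm g₂ ⊤ volume +
            eLpNorm (fun ξ : ℝ => ((jb ξ : ℝ) : ℂ) * g₂ ξ) 2 volume ≤ ENNReal.ofReal eps) →
        (eLpNorm g₃ ⊤ volume +
            eLpNorm (fun ξ : ℝ => ((jb ξ : ℝ) : ℂ) * g₃ ξ) 2 volume ≤ ENNReal.ofReal eps) →
        (eLpNorm (deriv g₁) 2 volume ≤ ENNReal.ofReal (eps * t ^ δ)) →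
        (eLpNorm (deriv g₂) 2 volume ≤ ENNReal.ofReal (eps * t ^ δ)) →
        (eLpNorm (deriv g₃) 2 volume ≤ ENNReal.ofReal (eps * t ^ δ)) →
      ∀ ξ : ℝ,
        ‖(∫ p : ℝ × ℝ, Complex.exp (2 * Complex.I * t * p.1 * p.2) * g₁ (ξ - p.1) *
              starRingEnd ℂ (g₂ (ξ - p.1 - p.2)) * g₃ (ξ - p.2)) -
            ((Real.pi / t : ℝ) : ℂ) * g₁ ξ * starRingEnd ℂ (g₂ ξ) * g₃ ξ‖ ≤
          C * eps ^ 3 * t ^ (-(6 : ℝ) / 5 + 3 * δ) := by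
  obtain ⟨K, hK⟩ := exists_integral_weight_mul_norm_fourier_le
  refine ⟨max 1 (4 * Real.pi * (2 * Real.pi ^ 2) ^ (1 / 5 : ℝ) * K ^ 2), le_max_left _ _, ?_⟩
  intro t ht eps heps _ g₁ g₂ g₃ hd₁ hd₂ hd₃ h₁ h₂ h₃ h₁' h₂' h₃' ξ
  have ht0 : 0 < t := by linarith
  have hA : 1 ≤ t ^ δ := Real.one_le_rpow ht hδ.le
  have hεA : 0 ≤ eps * t ^ δ := by positivity
  obtain ⟨d₁, i₁, -, n₁, n₁'⟩ := bounds_comp_const_sub heps.le hA hd₁ h₁ h₁' ξ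
  obtain ⟨d₂, i₂, -, n₂, n₂'⟩ := bounds_comp_const_sub heps.le hA hd₂ h₂ h₂' ξ
  obtain ⟨d₃, i₃, b₃, -, n₃'⟩ := bounds_comp_const_sub heps.le hA hd₃ h₃ h₃' ξ
  obtain ⟨w₁, k₁⟩ := hK _ _ hεA i₁ d₁ n₁ n₁'
  obtain ⟨w₂, k₂⟩ := hK _ _ hεA i₂ d₂ n₂ n₂'
  have key := norm_trilinear_sub_le heps.le hA ht d₁.continuous d₂.continuous d₃ i₁ i₂ i₃
    w₁ w₂ k₁ k₂ b₃ n₃'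
  simp only [sub_zero, ← sub_sub] at key
  have hpow : t ^ (-(6 : ℝ) / 5) * (t ^ δ) ^ 3 = t ^ (-(6 : ℝ) / 5 + 3 * δ) := by
    rw [← Real.rpow_mul_natCast ht0.le, ← Real.rpow_add ht0]
    congr 1; push_cast; ring
  rw [hpow] at key
  refine key.trans ?_
  gcongr
  exact le_max_right _ _
end
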